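/- If ALG_1 is a Bayesian-monotone MAB algorithm, then its greedy modification ALG_2 (with any mixing parameter p ∈ (0,1)) is also Bayesian-monotone. This follows from the identity BIR_2(n) = E[(1 − p)·BIR_1(M_n) + p·BIR^gr(M_n)] together with the fact that the Bayesian-greedy step can only get better with more information. -/

import Mathlib

/-
A formalization of the Bayesian-choice model of competing bandits.

Two principals each commit to a multi-armed bandit algorithm over a finite set
`A` of arms with Bernoulli rewards.  The mean-reward vector `w : A → ℝ` is drawn
once from a common Bayesian prior `P`.  An algorithm is a map from (reversed)
histories of (arm, reward) pairs to distributions over arms.  Agents arrive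
sequentially; agent `t` (rounds are 1-indexed) chooses principal 1 with
probability `fresp (PMR₁(t) - PMR₂(t))`, where `PMRᵢ(t)` is the Bayesian
posterior mean reward of principal `i`'s next local step; the chosen principal's
algorithm advances one local step.
-/

open MeasureTheory
open scoped Classical

namespace BayesianChoice

/-- A history: a list of (arm, Bernoulli reward) pairs, most recent step first. -/
abbrev History (A : Type) := List (A × Bool)

/-- An MAB algorithm: a distribution over arms, given the observed history.
(Note that such algorithms never depend on the time horizon `T`:
they are automatically `T`-oblivious.) -/
abbrev Alg (A : Type) := History A → PMF A

variable {A : Type} [Fintype A] [Nonempty A]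

/-- Likelihood of the reward sequence in history `h`, given mean-reward vector `w`
(rewards are Bernoulli, independent across steps given `w`). -/
noncomputable def lik (w : A → ℝ) : History A → ℝ
  | [] => 1
  | (a, r) :: h => lik w h * (if r then w a else 1 - w a)

/-- Probability that a stand-alone run of `alg` produces history `h`, given `w`. -/
noncomputable def hProb (alg : Alg A) (w : A → ℝ) : History A → ℝ
  | [] => 1
  | (a, r) :: h => hProb alg w h * ((alg h) a).toReal * (if r then w a else 1 - w a)

variable (P : Measure (A → ℝ))

/-- The prior `P` is supported on mean rewards in `[0,1]` (Bernoulli parameters). -/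
def PriorOnUnitCube : Prop := P {w | ∀ a : A, w a ∈ Set.Icc (0:ℝ) 1} = 1

/-- A history is feasible if it has positive marginal likelihood under the prior. -/
def Feasible (h : History A) : Prop := 0 < ∫ w, lik w h ∂P

/-- Posterior mean reward `E[μ_a | h]` of arm `a` given history `h`. -/
noncomputable def postMean (h : History A) (a : A) : ℝ :=
  (∫ w, w a * lik w h ∂P) / ∫ w, lik w h ∂P

/-- Prior assumption (i): each arm can be the (strictly) best arm. -/
def EachArmCanBeBest : Prop := ∀ a : A, 0 < P {w | ∀ a' : A, a' ≠ a → w a' < w a}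

/-- Prior assumption (ii): posterior mean rewards are pairwise distinct
given any feasible history. -/
def DistinctPosteriorMeans : Prop :=
  ∀ h : History A, Feasible P h → ∀ a a' : A, a ≠ a' → postMean P h a ≠ postMean P h a'

/-- `alg` is (a version of) `BayesGreedy`: on every feasible history it only plays arms
with the largest posterior mean reward. -/
def IsBayesGreedy (alg : Alg A) : Prop :=
  ∀ h : History A, Feasible P h →
    ∀ a ∈ (alg h).support, ∀ a' : A, postMean P h a' ≤ postMean P h a

/-- `alg` is (a version of) `StaticGreedy`: it always plays an arm with the largest
prior mean reward. -/
def IsStaticGreedy (alg : Alg A) : Prop :=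
  ∀ h : History A, ∀ a ∈ (alg h).support,
    ∀ a' : A, postMean P ([] : History A) a' ≤ postMean P ([] : History A) a

/-- Marginal probability that a stand-alone run of `alg` produces history `h`. -/
noncomputable def prH (alg : Alg A) (h : History A) : ℝ := ∫ w, hProb alg w h ∂P

/-- `alg` and `alg'` deviate at (local, 1-indexed) step `n`: there is a set `H` of
histories over the previous `n-1` steps, reached with positive probability by both
algorithms, on which they choose different distributions over arms. -/
def DeviatesAt (alg alg' : Alg A) (n : ℕ) : Prop :=
  ∃ H : Set (History A),
    (∀ h ∈ H, h.length + 1 = n) ∧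
    (∃ h ∈ H, 0 < prH P alg h) ∧ (∃ h ∈ H, 0 < prH P alg' h) ∧
    (∀ h ∈ H, alg h ≠ alg' h)

/-- `alg` deviates from `alg'` starting from step `n₀`:
`n₀` is the smallest step at which they deviate. -/
def DeviatesFrom (alg alg' : Alg A) (n₀ : ℕ) : Prop :=
  DeviatesAt P alg alg' n₀ ∧ ∀ n < n₀, ¬ DeviatesAt P alg alg' n

/-- `E[rew(n)]`: the Bayesian-expected reward collected at local step `n` (1-indexed)
by a stand-alone run of `alg`. -/
noncomputable def rewE (alg : Alg A) (n : ℕ) : ℝ :=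
  ∑' h : {h : History A // h.length + 1 = n},
    ∫ w, hProb alg w h.1 * ∑ a : A, ((alg h.1) a).toReal * w a ∂P

/-- `E[max_a μ_a]`: Bayesian-expected reward of the best arm. -/
noncomputable def optE : ℝ := ∫ w, ⨆ a : A, w a ∂P

/-- Bayesian instantaneous regret of `alg` at local step `n` (stand-alone run). -/
noncomputable def BIR (alg : Alg A) (n : ℕ) : ℝ := optE P - rewE P alg n

/-- `alg` is Bayesian-monotone: its Bayesian-expected reward is non-decreasing in `n`. -/
def BayesianMonotone (alg : Alg A) : Prop :=
  ∀ n m : ℕ, 1 ≤ n → n ≤ m → rewE P alg n ≤ rewE P alg m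

/- ### The competition game -/

/-- Bayesian-expected reward of the next local step of `alg`, when the joint
distribution over (mean vector, pair of local histories) has density `g` against `P`,
and `sel` extracts `alg`'s local history from the pair. -/
noncomputable def nextStepReward (alg : Alg A) (sel : History A × History A → History A)
    (g : (A → ℝ) → History A × History A → ℝ) : ℝ :=
  ∑' s : History A × History A, ∫ w, g w s * ∑ a : A, ((alg (sel s)) a).toReal * w a ∂P

/-- One global round of the game: the current agent chooses principal 1 with
probability `q`; the chosen principal's algorithm advances one local step. -/
noncomputable def stepDist (alg1 alg2 : Alg A) (q : ℝ)
    (g : (A → ℝ) → History A × History A → ℝ) :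
    (A → ℝ) → History A × History A → ℝ := fun w s =>
  (match s.1 with
   | [] => 0
   | (a, r) :: h1' =>
       q * g w (h1', s.2) * ((alg1 h1') a).toReal * (if r then w a else 1 - w a)) +
  (match s.2 with
   | [] => 0
   | (a, r) :: h2' =>
       (1 - q) * g w (s.1, h2') * ((alg2 h2') a).toReal * (if r then w a else 1 - w a))

/-- Joint distribution (density against the prior) over the pair of local histories
after `t` global rounds of the competition game, when the principals play
`(alg1, alg2)` and agents respond via `fresp`. -/
noncomputable def gameDist (alg1 alg2 : Alg A) (fresp : ℝ → ℝ) :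
    ℕ → (A → ℝ) → History A × History A → ℝ
  | 0 => fun _ s => if s = (([] : History A), ([] : History A)) then 1 else 0
  | t + 1 =>
      stepDist alg1 alg2
        (fresp (nextStepReward P alg1 Prod.fst (gameDist alg1 alg2 fresp t) -
                nextStepReward P alg2 Prod.snd (gameDist alg1 alg2 fresp t)))
        (gameDist alg1 alg2 fresp t)

/-- `PMR₁(t) = E[r_t | i_t = 1] = E[rew_1(n_1(t)+1)]`: posterior mean reward of
principal 1 at global round `t` (rounds are 1-indexed). -/
noncomputable def PMR1 (alg1 alg2 : Alg A) (fresp : ℝ → ℝ) (t : ℕ) : ℝ :=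
  nextStepReward P alg1 Prod.fst (gameDist P alg1 alg2 fresp (t - 1))

/-- `PMR₂(t)`: posterior mean reward of principal 2 at global round `t`. -/
noncomputable def PMR2 (alg1 alg2 : Alg A) (fresp : ℝ → ℝ) (t : ℕ) : ℝ :=
  nextStepReward P alg2 Prod.snd (gameDist P alg1 alg2 fresp (t - 1))

/-- Probability that agent `t` chooses principal 1:
`Pr[i_t = 1] = fresp (PMR₁(t) - PMR₂(t))`. -/
noncomputable def probChoose1 (alg1 alg2 : Alg A) (fresp : ℝ → ℝ) (t : ℕ) : ℝ :=
  fresp (PMR1 P alg1 alg2 fresp t - PMR2 P alg1 alg2 fresp t)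

/-- Expected number of the `T` agents that choose principal 1 (principal 1's utility). -/
noncomputable def marketShare1 (alg1 alg2 : Alg A) (fresp : ℝ → ℝ) (T : ℕ) : ℝ :=
  ∑ t ∈ Finset.Icc 1 T, probChoose1 P alg1 alg2 fresp t

/-- Expected number of the `T` agents that choose principal 2 (principal 2's utility). -/
noncomputable def marketShare2 (alg1 alg2 : Alg A) (fresp : ℝ → ℝ) (T : ℕ) : ℝ :=
  ∑ t ∈ Finset.Icc 1 T, (1 - probChoose1 P alg1 alg2 fresp t)

/-- `(a1, a2)` is a (pure) Nash equilibrium of the competition game with horizon `T`,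
response function `fresp`, and feasible strategy set `F`; each principal's utility
is the expected number of agents who choose her. -/
def IsNash (F : Set (Alg A)) (fresp : ℝ → ℝ) (T : ℕ) (a1 a2 : Alg A) : Prop :=
  a1 ∈ F ∧ a2 ∈ F ∧
  (∀ a1' ∈ F, marketShare1 P a1' a2 fresp T ≤ marketShare1 P a1 a2 fresp T) ∧
  (∀ a2' ∈ F, marketShare2 P a1 a2' fresp T ≤ marketShare2 P a1 a2 fresp T)

/- ### Response functions -/

/-- `HardMax` response function (its value at `0` — the tie-breaking rule —
is specified separately). -/
def IsHardMax (f : ℝ → ℝ) : Prop :=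
  (∀ x : ℝ, 0 < x → f x = 1) ∧ (∀ x : ℝ, x < 0 → f x = 0)

/-- `HardMax&Random` response function with baseline probability `ε₀ = f(-1)`. -/
def IsHardMaxRandom (f : ℝ → ℝ) (ε₀ : ℝ) : Prop :=
  ε₀ ∈ Set.Ioo (0:ℝ) (1/2 : ℝ) ∧ f (-1) = ε₀ ∧
  (∀ x : ℝ, 0 < x → f x = 1 - ε₀) ∧ (∀ x : ℝ, x < 0 → f x = ε₀)

/-- A symmetric response function: `f(x) + f(-x) = 1` for all `x ∈ [0,1]`. -/
def SymmetricResp (f : ℝ → ℝ) : Prop := ∀ x ∈ Set.Icc (0:ℝ) 1, f x + f (-x) = 1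

/-- `SoftMax` response function with smoothness constants `δ₀, c₀, c₀'`. -/
def IsSoftMax (f : ℝ → ℝ) (δ₀ c₀ c₀' : ℝ) : Prop :=
  (∃ ε ∈ Set.Ioo (0:ℝ) (1/2 : ℝ), ∀ x : ℝ, f x ∈ Set.Icc ε (1 - ε)) ∧
  f 0 = 1/2 ∧ 0 < δ₀ ∧ 0 < c₀ ∧ 0 < c₀' ∧
  ∀ x ∈ Set.Icc (-δ₀) δ₀, DifferentiableAt ℝ f x ∧ c₀ ≤ deriv f x ∧ deriv f x ≤ c₀'

/-- `alg1` BIR-dominates `alg2` starting from step `n₀`: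
`BIR₁(ε₀ n / 2) / BIR₂(n) < 1/2` for all `n ≥ n₀`. -/
def BIRDominates (alg1 alg2 : Alg A) (ε₀ : ℝ) (n₀ : ℕ) : Prop :=
  ∀ n : ℕ, n₀ ≤ n → BIR P alg1 ⌊ε₀ * n / 2⌋₊ / BIR P alg2 n < 1/2

/-- `alg1` weakly BIR-dominates `alg2` with constants `β₀, α₀ ∈ (0,1/2)`, from step `n₀`:
`BIR₁((1-β₀) n) / BIR₂(n) < 1 - α₀` for all `n ≥ n₀`. -/
def WeakBIRDominates (alg1 alg2 : Alg A) (β₀ α₀ : ℝ) (n₀ : ℕ) : Prop :=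
  ∀ n : ℕ, n₀ ≤ n → BIR P alg1 ⌊(1 - β₀) * n⌋₊ / BIR P alg2 n < 1 - α₀

end BayesianChoice


namespace BayesianChoice

/- ### The greedy modification of an algorithm -/

variable {A : Type} [Fintype A] [Nonempty A] (P : Measure (A → ℝ))

/-- An arm with the largest posterior mean reward given history `h`
(the "Bayesian-greedy choice" on the data `h`). -/
noncomputable def greedyArm (h : History A) : A :=
  Classical.choose
    (Finset.exists_max_image (Finset.univ : Finset A) (postMean P h) Finset.univ_nonempty)

/-- Stand-alone run of the greedy modification of `alg1` with mixing parameter `p`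
(mixing is active from local step `n₀` on):  `gmDist alg1 p n₀ w n h` is the
probability, given mean vector `w`, that after `n` local steps the *recorded* history
(the data collected by the invocations of `alg1`, most recent first) equals `h`.
In each step `n < n₀` it invokes `alg1` (which there coincides with `BayesGreedy`);
in each step `n ≥ n₀`, with probability `p` it makes the greedy choice (whose data is
not recorded), and with probability `1 - p` it invokes `alg1` and records the data. -/
noncomputable def gmDist (alg1 : Alg A) (p : ℝ) (n₀ : ℕ) (w : A → ℝ) :
    ℕ → History A → ℝ
  | 0, h => if h = [] then 1 else 0
  | n + 1, h =>
      (if n + 1 < n₀ then 0 else p * gmDist alg1 p n₀ w n h) +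
      (if n + 1 < n₀ then 1 else 1 - p) *
        (match h with
         | [] => 0
         | (a, r) :: h' =>
             gmDist alg1 p n₀ w n h' * ((alg1 h') a).toReal * (if r then w a else 1 - w a))

/-- Bayesian-expected reward collected at local step `n` (1-indexed) by a stand-alone
run of the greedy modification of `alg1` with mixing parameter `p` (mixing from `n₀`). -/
noncomputable def gmRewE (alg1 : Alg A) (p : ℝ) (n₀ n : ℕ) : ℝ :=
  ∑' h : History A,
    ∫ w, gmDist alg1 p n₀ w (n - 1) h *
      (if n < n₀ then ∑ a : A, ((alg1 h) a).toReal * w a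
       else (1 - p) * ∑ a : A, ((alg1 h) a).toReal * w a + p * w (greedyArm P h)) ∂P

/-- Bayesian instantaneous regret of the greedy modification at local step `n`. -/
noncomputable def gmBIR (alg1 : Alg A) (p : ℝ) (n₀ n : ℕ) : ℝ :=
  optE P - gmRewE P alg1 p n₀ n

/-- `Pr[M_n = m]`: probability that `alg1` is invoked exactly `m` times in the first
`n` steps of the greedy modification (equivalently, that the recorded history has
length `m` after `n` steps). -/
noncomputable def Mdist (alg1 : Alg A) (p : ℝ) (n₀ n m : ℕ) : ℝ :=
  ∑' h : {h : History A // h.length = m}, ∫ w, gmDist alg1 p n₀ w n h.1 ∂P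

/-- `E[M_n]`: expected number of invocations of `alg1` in the first `n` steps. -/
noncomputable def Mmean (alg1 : Alg A) (p : ℝ) (n₀ n : ℕ) : ℝ :=
  ∑' m : ℕ, (m : ℝ) * Mdist P alg1 p n₀ n m

/-- `BIR^gr(m)`: the Bayesian instantaneous regret of the hypothetical algorithm that
at each step `m` outputs the Bayesian-greedy choice based on the data collected by
`alg1` in its first `m - 1` steps. -/
noncomputable def BIRgr (alg1 : Alg A) (m : ℕ) : ℝ :=
  optE P - ∑' h : {h : History A // h.length + 1 = m},
    ∫ w, hProb alg1 w h.1 * w (greedyArm P h.1) ∂P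

/-- `E[reg₂(n) | M_n = m]`: conditional expectation of the (frequentist) instantaneous
regret `reg₂(n) = max_a μ_a - rew₂(n)` of the greedy modification at step `n`,
given that `alg1` is invoked `m` times in the first `n` steps. -/
noncomputable def condRegret (alg1 : Alg A) (p : ℝ) (n₀ n m : ℕ) : ℝ :=
  ((1 - p) * ∑' h : {h : History A // h.length + 1 = m},
      ∫ w, gmDist alg1 p n₀ w (n - 1) h.1 *
        ((⨆ a : A, w a) - ∑ a : A, ((alg1 h.1) a).toReal * w a) ∂P
   + p * ∑' h : {h : History A // h.length = m},
      ∫ w, gmDist alg1 p n₀ w (n - 1) h.1 *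
        ((⨆ a : A, w a) - w (greedyArm P h.1)) ∂P)
  / Mdist P alg1 p n₀ n m

/- ### The competition game against the greedy modification -/

/-- Bayesian-expected reward of the next local step of the greedy modification,
given its local state `s = (recorded history, number of local steps taken)`. -/
noncomputable def gmStepReward (alg1 : Alg A) (p : ℝ) (n₀ : ℕ) (w : A → ℝ)
    (s : History A × ℕ) : ℝ :=
  if s.2 + 1 < n₀ then ∑ a : A, ((alg1 s.1) a).toReal * w a
  else (1 - p) * ∑ a : A, ((alg1 s.1) a).toReal * w a + p * w (greedyArm P s.1)

/-- One global round of the competition game in which principal 1 plays `alg1` and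
principal 2 plays the greedy modification of `alg1`; the agent chooses principal 1
with probability `q`.  The joint state records principal 1's local history and
principal 2's local state (recorded history, number of local steps taken). -/
noncomputable def gmGameStep (alg1 : Alg A) (p : ℝ) (n₀ : ℕ) (q : ℝ)
    (g : (A → ℝ) → History A × (History A × ℕ) → ℝ) :
    (A → ℝ) → History A × (History A × ℕ) → ℝ := fun w s =>
  (match s.1 with
   | [] => 0
   | (a, r) :: h1' =>
       q * g w (h1', s.2) * ((alg1 h1') a).toReal * (if r then w a else 1 - w a)) +
  (match s.2.2 with
   | 0 => 0
   | n + 1 =>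
     if n + 1 < n₀ then
       (match s.2.1 with
        | [] => 0
        | (a, r) :: h2' =>
            (1 - q) * g w (s.1, (h2', n)) * ((alg1 h2') a).toReal *
              (if r then w a else 1 - w a))
     else
       (1 - q) * p * g w (s.1, (s.2.1, n)) +
       (match s.2.1 with
        | [] => 0
        | (a, r) :: h2' =>
            (1 - q) * (1 - p) * g w (s.1, (h2', n)) * ((alg1 h2') a).toReal *
              (if r then w a else 1 - w a)))

/-- Bayesian-expected reward of principal 1's next local step, given joint density `g`. -/
noncomputable def gmNext1 (alg1 : Alg A)
    (g : (A → ℝ) → History A × (History A × ℕ) → ℝ) : ℝ :=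
  ∑' s : History A × (History A × ℕ),
    ∫ w, g w s * ∑ a : A, ((alg1 s.1) a).toReal * w a ∂P

/-- Bayesian-expected reward of principal 2's (the greedy modification's) next local
step, given joint density `g`. -/
noncomputable def gmNext2 (alg1 : Alg A) (p : ℝ) (n₀ : ℕ)
    (g : (A → ℝ) → History A × (History A × ℕ) → ℝ) : ℝ :=
  ∑' s : History A × (History A × ℕ), ∫ w, g w s * gmStepReward P alg1 p n₀ w s.2 ∂P

/-- Joint state distribution after `t` global rounds when principal 1 plays `alg1`
and principal 2 plays the greedy modification of `alg1` (mixing parameter `p`,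
mixing from step `n₀`), and agents respond via `fresp`. -/
noncomputable def gmGameDist (alg1 : Alg A) (p : ℝ) (n₀ : ℕ) (fresp : ℝ → ℝ) :
    ℕ → (A → ℝ) → History A × (History A × ℕ) → ℝ
  | 0 => fun _ s => if s = (([] : History A), (([] : History A), 0)) then 1 else 0
  | t + 1 =>
      gmGameStep alg1 p n₀
        (fresp (gmNext1 P alg1 (gmGameDist alg1 p n₀ fresp t) -
                gmNext2 P alg1 p n₀ (gmGameDist alg1 p n₀ fresp t)))
        (gmGameDist alg1 p n₀ fresp t)

/-- Probability that agent `t` chooses principal 1, when principal 2 plays the greedy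
modification of principal 1's algorithm `alg1`. -/
noncomputable def probChoose1GM (alg1 : Alg A) (p : ℝ) (n₀ : ℕ) (fresp : ℝ → ℝ)
    (t : ℕ) : ℝ :=
  fresp (gmNext1 P alg1 (gmGameDist P alg1 p n₀ fresp (t - 1)) -
         gmNext2 P alg1 p n₀ (gmGameDist P alg1 p n₀ fresp (t - 1)))

end BayesianChoice

namespace BayesianChoice

open MeasureTheory

section helpers

variable {A : Type} [Fintype A] [Nonempty A]

/-- factor of `hProb` depending on the algorithm only -/
noncomputable def hq (alg : Alg A) : History A → ℝ
  | [] => 1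
  | (a, _) :: h => hq alg h * ((alg h) a).toReal

/-- law of the number of recorded steps -/
noncomputable def cc (p : ℝ) (n₀ : ℕ) : ℕ → ℕ → ℝ
  | 0, k => if k = 0 then 1 else 0
  | n + 1, k =>
      (if n + 1 < n₀ then 0 else p * cc p n₀ n k) +
      (if n + 1 < n₀ then 1 else 1 - p) *
        (match k with
         | 0 => 0
         | k + 1 => cc p n₀ n k)

/-- histories of length `k` -/
noncomputable def LL (A : Type) [Fintype A] (k : ℕ) : Finset (History A) :=
  (List.finite_length_eq (A × Bool) k).toFinset

lemma mem_LL {k : ℕ} {h : History A} : h ∈ LL A k ↔ h.length = k := by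
  simp [LL]

lemma sum_LL_succ (k : ℕ) (f : History A → ℝ) :
    ∑ h ∈ LL A (k+1), f h = ∑ h ∈ LL A k, ∑ x : A × Bool, f (x :: h) := by
  rw [← Finset.sum_product']
  symm
  refine Finset.sum_bij (fun x _ => x.2 :: x.1) ?_ ?_ ?_ ?_
  · rintro ⟨h, x⟩ hx
    simp only [Finset.mem_product, mem_LL] at hx
    simp [mem_LL, hx.1]
  · rintro ⟨h, x⟩ _ ⟨h', x'⟩ _ e
    simp at e
    simp [e.1, e.2]
  · intro h hh
    rw [mem_LL] at hh
    cases h with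
    | nil => simp at hh
    | cons x h =>
      simp at hh
      exact ⟨(h, x), by simp [mem_LL, hh], rfl⟩
  · intros; rfl

lemma hProb_eq (alg : Alg A) (w : A → ℝ) (h : History A) :
    hProb alg w h = hq alg h * lik w h := by
  induction h with
  | nil => simp [hProb, hq, lik]
  | cons x h ih =>
    obtain ⟨a, r⟩ := x
    simp only [hProb, hq, lik, ih]; ring

lemma hq_nonneg (alg : Alg A) (h : History A) : 0 ≤ hq alg h := by
  induction h with
  | nil => simp [hq]
  | cons x h ih =>
    obtain ⟨a, r⟩ := x
    simp only [hq]
    exact mul_nonneg ih ENNReal.toReal_nonneg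

lemma gmDist_eq (alg : Alg A) (p : ℝ) (n₀ : ℕ) (w : A → ℝ) (n : ℕ) (h : History A) :
    gmDist alg p n₀ w n h = cc p n₀ n h.length * (hq alg h * lik w h) := by
  induction n generalizing h with
  | zero =>
    cases h <;> simp [gmDist, cc, hq, lik]
  | succ n ih =>
    cases h with
    | nil => simp [gmDist, cc, ih, hq, lik]
    | cons x h =>
      obtain ⟨a, r⟩ := x
      simp only [gmDist, cc, ih, hq, lik, List.length_cons]
      split_ifs <;> ring

lemma cc_nonneg {p : ℝ} (hp : p ∈ Set.Ioo (0:ℝ) 1) (n₀ n k : ℕ) : 0 ≤ cc p n₀ n k := by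
  induction n generalizing k with
  | zero => simp only [cc]; split_ifs <;> norm_num
  | succ n ih =>
    simp only [cc]
    have h1 : (0:ℝ) ≤ 1 - p := by linarith [hp.2]
    have h0 := hp.1.le
    cases k with
    | zero =>
      have := mul_nonneg h0 (ih 0)
      split_ifs <;> simp [this]
    | succ k =>
      have := mul_nonneg h0 (ih (k+1))
      have h2 := mul_nonneg h1 (ih k)
      have h3 := ih k
      split_ifs <;> simp only [] <;> linarith

lemma cc_zero (p : ℝ) (n₀ n k : ℕ) (hk : n < k) : cc p n₀ n k = 0 := by
  induction n generalizing k with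
  | zero => simp only [cc]; rw [if_neg (by omega)]
  | succ n ih =>
    cases k with
    | zero => omega
    | succ k =>
      simp only [cc]
      rw [ih (k+1) (by omega), ih k (by omega)]; simp

lemma sum_cc_succ (p : ℝ) (n₀ n : ℕ) (V : ℕ → ℝ) :
    ∑ k ∈ Finset.range (n+2), cc p n₀ (n+1) k * V k =
      ∑ k ∈ Finset.range (n+1), cc p n₀ n k *
        ((if n + 1 < n₀ then 0 else p) * V k + (if n + 1 < n₀ then 1 else 1 - p) * V (k+1)) := by
  have e : ∀ k, cc p n₀ (n+1) k * V k =
      (if n + 1 < n₀ then 0 else p) * (cc p n₀ n k * V k) +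
      (if n + 1 < n₀ then 1 else 1 - p) * ((match k with
         | 0 => 0
         | k + 1 => cc p n₀ n k) * V k) := by
    intro k
    simp only [cc]
    split_ifs <;> ring
  simp only [e]
  rw [Finset.sum_add_distrib, ← Finset.mul_sum, ← Finset.mul_sum]
  rw [Finset.sum_range_succ (fun k => cc p n₀ n k * V k) (n+1), cc_zero p n₀ n (n+1) (by omega)]
  rw [Finset.sum_range_succ' _ (n+1)]
  simp only [zero_mul, add_zero]
  rw [Finset.mul_sum, Finset.mul_sum, ← Finset.sum_add_distrib]
  refine Finset.sum_congr rfl fun k _ => ?_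
  ring

variable (P : Measure (A → ℝ)) [IsProbabilityMeasure P]

lemma ae_cube (hcube : PriorOnUnitCube P) : ∀ᵐ w ∂P, ∀ a : A, w a ∈ Set.Icc (0:ℝ) 1 := by
  have hm : MeasurableSet {w : A → ℝ | ∀ a : A, w a ∈ Set.Icc (0:ℝ) 1} := by
    have : {w : A → ℝ | ∀ a : A, w a ∈ Set.Icc (0:ℝ) 1} =
        ⋂ a, (fun w : A → ℝ => w a) ⁻¹' Set.Icc (0:ℝ) 1 := by ext; simp
    rw [this]
    exact MeasurableSet.iInter fun a => measurableSet_Icc.preimage (measurable_pi_apply a)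
  exact (mem_ae_iff_prob_eq_one hm).2 hcube

lemma lik_mem (w : A → ℝ) (hw : ∀ a : A, w a ∈ Set.Icc (0:ℝ) 1) (h : History A) :
    lik w h ∈ Set.Icc (0:ℝ) 1 := by
  induction h with
  | nil => simp [lik]
  | cons x h ih =>
    obtain ⟨a, r⟩ := x
    simp only [lik]
    have := hw a
    have h2 : (if r then w a else 1 - w a) ∈ Set.Icc (0:ℝ) 1 := by
      split_ifs
      · exact this
      · exact ⟨by linarith [this.2], by linarith [this.1]⟩
    exact ⟨mul_nonneg ih.1 h2.1, mul_le_one₀ ih.2 h2.1 h2.2⟩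

lemma meas_lik (h : History A) : Measurable (fun w : A → ℝ => lik w h) := by
  induction h with
  | nil => simp only [lik]; exact measurable_const
  | cons x h ih =>
    obtain ⟨a, r⟩ := x
    simp only [lik]
    refine ih.mul ?_
    cases r
    · simp only [Bool.false_eq_true, if_false]
      exact measurable_const.sub (measurable_pi_apply a)
    · simpa using measurable_pi_apply a

lemma int_lik (hcube : PriorOnUnitCube P) (h : History A) :
    Integrable (fun w : A → ℝ => lik w h) P := by
  refine Integrable.of_bound (meas_lik h).aestronglyMeasurable 1 ?_
  filter_upwards [ae_cube P hcube] with w hw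
  have := lik_mem w hw h
  rw [Real.norm_eq_abs, abs_le]
  exact ⟨by linarith [this.1], this.2⟩

lemma int_wlik (hcube : PriorOnUnitCube P) (h : History A) (b : A) :
    Integrable (fun w : A → ℝ => w b * lik w h) P := by
  refine Integrable.of_bound ((measurable_pi_apply b).mul (meas_lik h)).aestronglyMeasurable 1 ?_
  filter_upwards [ae_cube P hcube] with w hw
  have := lik_mem w hw h
  have h2 := hw b
  rw [Real.norm_eq_abs, abs_le]
  exact ⟨by linarith [mul_nonneg h2.1 this.1], mul_le_one₀ h2.2 this.1 this.2⟩

/-- unnormalized posterior mean -/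
noncomputable def II (h : History A) (b : A) : ℝ := ∫ w, w b * lik w h ∂P

lemma II_greedy (hcube : PriorOnUnitCube P) (h : History A) (b : A) :
    II P h b ≤ II P h (greedyArm P h) := by
  have hspec := (Classical.choose_spec (Finset.exists_max_image (Finset.univ : Finset A)
    (postMean P h) Finset.univ_nonempty)).2 b (Finset.mem_univ _)
  change postMean P h b ≤ postMean P h (greedyArm P h) at hspec
  have hnn : 0 ≤ᵐ[P] fun w : A → ℝ => lik w h := by
    filter_upwards [ae_cube P hcube] with w hw using (lik_mem w hw h).1
  rcases (integral_nonneg_of_ae hnn).lt_or_eq with hZ | hZ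
  · unfold postMean at hspec
    exact (div_le_div_iff_of_pos_right hZ).1 hspec
  · have h0 := (integral_eq_zero_iff_of_nonneg_ae hnn (int_lik P hcube h)).1 hZ.symm
    have : ∀ b, II P h b = 0 := by
      intro b
      unfold II
      refine integral_eq_zero_of_ae ?_
      filter_upwards [h0] with w hw
      simp only [Pi.zero_apply] at hw ⊢
      rw [hw, mul_zero]
    rw [this, this]

lemma II_split (hcube : PriorOnUnitCube P) (h : History A) (a b : A) :
    II P ((a, true) :: h) b + II P ((a, false) :: h) b = II P h b := by
  unfold II
  rw [← integral_add (int_wlik P hcube _ b) (int_wlik P hcube _ b)]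
  congr 1; ext w; simp [lik]; ring

lemma sum_alg (alg : Alg A) (h : History A) : ∑ a : A, ((alg h) a).toReal = 1 := by
  have := (alg h).tsum_coe
  rw [tsum_fintype] at this
  rw [← ENNReal.toReal_sum (fun a _ => (alg h).apply_ne_top a), this]; simp

noncomputable def RR (alg : Alg A) (k : ℕ) : ℝ :=
  ∑ h ∈ LL A k, hq alg h * ∑ a : A, ((alg h) a).toReal * II P h a

noncomputable def GG (alg : Alg A) (k : ℕ) : ℝ :=
  ∑ h ∈ LL A k, hq alg h * II P h (greedyArm P h)

lemma RR_le_GG (hcube : PriorOnUnitCube P) (alg : Alg A) (k : ℕ) : RR P alg k ≤ GG P alg k := by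
  refine Finset.sum_le_sum fun h _ => mul_le_mul_of_nonneg_left ?_ (hq_nonneg alg h)
  calc _ ≤ ∑ a : A, ((alg h) a).toReal * II P h (greedyArm P h) :=
        Finset.sum_le_sum fun a _ =>
          mul_le_mul_of_nonneg_left (II_greedy P hcube h a) ENNReal.toReal_nonneg
    _ = _ := by rw [← Finset.sum_mul, sum_alg, one_mul]

lemma GG_mono (hcube : PriorOnUnitCube P) (alg : Alg A) (k : ℕ) :
    GG P alg k ≤ GG P alg (k+1) := by
  unfold GG
  rw [sum_LL_succ]
  refine Finset.sum_le_sum fun h _ => ?_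
  rw [Fintype.sum_prod_type]
  calc _ = ∑ a : A, hq alg h * ((alg h) a).toReal * II P h (greedyArm P h) := by
        rw [← Finset.sum_mul, ← Finset.mul_sum, sum_alg, mul_one]
    _ ≤ _ := by
        refine Finset.sum_le_sum fun a _ => ?_
        rw [Fintype.sum_bool, ← II_split P hcube h a, mul_add]
        simp only [hq]
        have := mul_nonneg (hq_nonneg alg h) (ENNReal.toReal_nonneg (a := (alg h) a))
        exact add_le_add (mul_le_mul_of_nonneg_left (II_greedy P hcube _ _) this)
          (mul_le_mul_of_nonneg_left (II_greedy P hcube _ _) this)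

lemma int_alg (hcube : PriorOnUnitCube P) (alg : Alg A) (h : History A) :
    ∫ w, lik w h * ∑ a : A, ((alg h) a).toReal * w a ∂P =
      ∑ a : A, ((alg h) a).toReal * II P h a := by
  unfold II
  simp_rw [← integral_const_mul]
  rw [← integral_finsetSum]
  · congr 1; ext w; rw [Finset.mul_sum]
    exact Finset.sum_congr rfl fun a _ => by ring
  · exact fun a _ => (int_wlik P hcube h a).const_mul _

lemma integrable_alg (hcube : PriorOnUnitCube P) (alg : Alg A) (h : History A) :
    Integrable (fun w => lik w h * ∑ a : A, ((alg h) a).toReal * w a) P := by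
  have := integrable_finsetSum (μ := P) (Finset.univ : Finset A)
    (f := fun a w => ((alg h) a).toReal * (w a * lik w h))
    (fun a _ => (int_wlik P hcube h a).const_mul _)
  refine this.congr (Filter.Eventually.of_forall fun w => ?_)
  simp only []
  rw [Finset.mul_sum]
  exact Finset.sum_congr rfl fun a _ => by ring

lemma rewE_eq (hcube : PriorOnUnitCube P) (alg : Alg A) (k : ℕ) :
    rewE P alg (k+1) = RR P alg k := by
  unfold rewE RR
  have hs : {h : History A | h.length + 1 = k + 1} = ↑(LL A k) := by
    ext h; simp [mem_LL]
  have := tsum_subtype {h : History A | h.length + 1 = k + 1}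
    (fun h => ∫ w, hProb alg w h * ∑ a : A, ((alg h) a).toReal * w a ∂P)
  refine this.trans ?_
  rw [hs, ← tsum_subtype]
  refine (Finset.tsum_subtype' (LL A k)
    (fun h => ∫ w, hProb alg w h * ∑ a : A, ((alg h) a).toReal * w a ∂P)).trans ?_
  refine Finset.sum_congr rfl fun h _ => ?_
  rw [← int_alg P hcube, ← integral_const_mul]
  congr 1; ext w; rw [hProb_eq]; ring

lemma gmRewE_eq (hcube : PriorOnUnitCube P) (alg : Alg A) (p : ℝ) (n₀ n : ℕ) :
    gmRewE P alg p n₀ (n+1) = ∑ k ∈ Finset.range (n+1), cc p n₀ n k *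
      (if n + 1 < n₀ then RR P alg k else (1 - p) * RR P alg k + p * GG P alg k) := by
  unfold gmRewE
  have e : ∀ h : History A, ∫ w, gmDist alg p n₀ w (n + 1 - 1) h *
      (if n + 1 < n₀ then ∑ a : A, ((alg h) a).toReal * w a
       else (1 - p) * ∑ a : A, ((alg h) a).toReal * w a + p * w (greedyArm P h)) ∂P =
      cc p n₀ n h.length * (if n + 1 < n₀ then hq alg h * ∑ a : A, ((alg h) a).toReal * II P h a
        else (1 - p) * (hq alg h * ∑ a : A, ((alg h) a).toReal * II P h a)
          + p * (hq alg h * II P h (greedyArm P h))) := by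
    intro h
    rw [← int_alg P hcube]
    simp only [gmDist_eq, Nat.add_sub_cancel]
    split_ifs
    · rw [← integral_const_mul, ← integral_const_mul]
      congr 1; ext w; ring
    · unfold II
      simp_rw [← integral_const_mul]
      rw [← integral_add, ← integral_const_mul]
      · congr 1; ext w; ring
      · exact ((integrable_alg P hcube alg h).const_mul _).const_mul _
      · exact ((int_wlik P hcube h _).const_mul _).const_mul _
  simp_rw [e]
  rw [tsum_eq_sum (s := (Finset.range (n+1)).biUnion (LL A))]
  · rw [Finset.sum_biUnion]
    · refine Finset.sum_congr rfl fun k _ => ?_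
      have : ∀ h ∈ LL A k, h.length = k := fun h hh => mem_LL.1 hh
      rw [Finset.sum_congr rfl (fun h hh => by rw [this h hh]), ← Finset.mul_sum]
      congr 1
      split_ifs
      · rfl
      · rw [Finset.sum_add_distrib, ← Finset.mul_sum, ← Finset.mul_sum]; rfl
    · intro i _ j _ hij
      refine Finset.disjoint_left.2 fun h h1 h2 => hij ?_
      rw [mem_LL] at h1 h2
      omega
  · intro h hh
    rw [cc_zero, zero_mul]
    by_contra hlt
    exact hh (Finset.mem_biUnion.2 ⟨h.length, Finset.mem_range.2 (by omega), mem_LL.2 rfl⟩)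

end helpers

/-- **The greedy modification of a Bayesian-monotone algorithm is Bayesian-monotone.**
If `alg1` is a Bayesian-monotone MAB algorithm, then its greedy modification (with any
mixing parameter `p ∈ (0,1)`, mixing active from step `n₀` where `alg1` deviates from
`BayesGreedy`) is also Bayesian-monotone: its Bayesian-expected reward at local step
`n` is non-decreasing in `n`. -/
theorem greedy_modification_bayesianMonotone
    {A : Type} [Fintype A] [Nonempty A]
    (P : Measure (A → ℝ)) [IsProbabilityMeasure P]
    (hcube : PriorOnUnitCube P)
    (alg1 : Alg A) (hmono : BayesianMonotone P alg1)
    (bg : Alg A) (hbg : IsBayesGreedy P bg)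
    (n₀ : ℕ) (hdev : DeviatesFrom P alg1 bg n₀)
    (p : ℝ) (hp : p ∈ Set.Ioo (0:ℝ) 1) :
    ∀ n m : ℕ, 1 ≤ n → n ≤ m → gmRewE P alg1 p n₀ n ≤ gmRewE P alg1 p n₀ m := by
  have key : ∀ n, gmRewE P alg1 p n₀ (n+1) ≤ gmRewE P alg1 p n₀ (n+1+1) := by
    intro n
    rw [gmRewE_eq P hcube, gmRewE_eq P hcube, sum_cc_succ]
    refine Finset.sum_le_sum fun k _ => mul_le_mul_of_nonneg_left ?_ (cc_nonneg hp n₀ n k)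
    have hR : RR P alg1 k ≤ RR P alg1 (k+1) := by
      have := hmono (k+1) (k+1+1) (by omega) (by omega)
      rwa [rewE_eq P hcube, rewE_eq P hcube] at this
    have hG := GG_mono P hcube alg1 k
    have hRG := RR_le_GG P hcube alg1 (k+1)
    obtain ⟨hp0, hp1⟩ := hp
    have hp1' : 0 ≤ 1 - p := by linarith
    have hV : (1 - p) * RR P alg1 k + p * GG P alg1 k ≤
        (1 - p) * RR P alg1 (k+1) + p * GG P alg1 (k+1) :=
      add_le_add (mul_le_mul_of_nonneg_left hR hp1') (mul_le_mul_of_nonneg_left hG hp0.le)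
    have hW : RR P alg1 (k+1) ≤ (1 - p) * RR P alg1 (k+1) + p * GG P alg1 (k+1) := by
      nlinarith [mul_le_mul_of_nonneg_left hRG hp0.le]
    by_cases h1 : n + 1 < n₀
    · simp only [if_pos h1]
      split_ifs
      · linarith
      · linarith
    · have h2 : ¬ (n + 1 + 1 < n₀) := by omega
      simp only [if_neg h1, if_neg h2]
      nlinarith [mul_le_mul_of_nonneg_left hV hp1']
  intro n m hn hnm
  induction m, hnm using Nat.le_induction with
  | base => exact le_rfl
  | succ m hm ih =>
    obtain ⟨m, rfl⟩ : ∃ m', m = m' + 1 := ⟨m - 1, by omega⟩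
    exact ih.trans (key m)

end BayesianChoice
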